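/- arXiv:1704.07149 — 3 statements merged into one kernel-verified Lean document; each statement's English description precedes it below -/
import Mathlib

section
/- Soundness of the tree sequent calculus TEFL: if a tree sequent Γ ⇒^T Δ is provable in TEFL, then for every model M and every T-assignment f in M, the sequent Γ ⇒^T Δ is true in (M, f). -/
set_option autoImplicit false

/-- Formulas of Epistemic Logic of Friendship:
    nominals, propositional variables, ⊥, →, @ₙ, F, □. -/
inductive Form : Type
  | nom : ℕ → Form
  | pv  : ℕ → Form
  | bot : Form
  | imp : Form → Form → Form
  | atf : ℕ → Form → Form
  | fr  : Form → Form
  | box : Form → Form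
  deriving DecidableEq

def Form.neg (φ : Form) : Form := Form.imp φ Form.bot
def Form.top : Form := Form.neg Form.bot
def Form.and (φ ψ : Form) : Form := Form.neg (Form.imp φ (Form.neg ψ))
def Form.or (φ ψ : Form) : Form := Form.imp (Form.neg φ) ψ
def Form.iff (φ ψ : Form) : Form := Form.and (Form.imp φ ψ) (Form.imp ψ φ)
/-- ⟨F⟩φ := ¬F¬φ -/
def Form.diaF (φ : Form) : Form := Form.neg (Form.fr (Form.neg φ))

/-- `Form.sub m k φ` is φ[m/k] : substitute nominal k by nominal m. -/
def Form.sub (m k : ℕ) : Form → Form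
  | .nom n => if n = k then .nom m else .nom n
  | .pv p => .pv p
  | .bot => .bot
  | .imp φ ψ => .imp (Form.sub m k φ) (Form.sub m k ψ)
  | .atf n φ => .atf (if n = k then m else n) (Form.sub m k φ)
  | .fr φ => .fr (Form.sub m k φ)
  | .box φ => .box (Form.sub m k φ)

/-- nominals occurring in a formula -/
def Form.noms : Form → Finset ℕ
  | .nom n => {n}
  | .pv _ => ∅
  | .bot => ∅
  | .imp φ ψ => Form.noms φ ∪ Form.noms ψ
  | .atf n φ => insert n (Form.noms φ)
  | .fr φ => Form.noms φ
  | .box φ => Form.noms φ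

/-- Labels: natural numbers are labels, and `child α n i` is the label α·ₙi,
    an n-child of α. -/
inductive Label : Type
  | root : ℕ → Label
  | child : Label → ℕ → ℕ → Label
  deriving DecidableEq

/-- nominals occurring in a label -/
def Label.noms : Label → Finset ℕ
  | .root _ => ∅
  | .child α n _ => insert n (Label.noms α)

/-- natural numbers occurring in a label -/
def Label.nats : Label → Finset ℕ
  | .root j => {j}
  | .child α _ i => insert i (Label.nats α)

/-- apply a nominal renaming to (the edge nominals of) a label -/
def Label.subst (σn : ℕ → ℕ) : Label → Label
  | .root j => .root j
  | .child α n i => .child (Label.subst σn α) (σn n) i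

/-- A labelled formula (α, φ) stands for α:φ, where φ is intended @-prefixed. -/
abbrev LForm : Type := Label × Form

/-- A finite tree of labels: a unique natural-number root, closed under parents. -/
def IsTree (T : Finset Label) : Prop :=
  (∃! j : ℕ, Label.root j ∈ T) ∧ ∀ α n i, Label.child α n i ∈ T → α ∈ T

/-- A (possibly infinite) tree of labels. -/
def SetIsTree (T : Set Label) : Prop :=
  (∃! j : ℕ, Label.root j ∈ T) ∧ ∀ α n i, Label.child α n i ∈ T → α ∈ T

/-- A frame: states, agents, accessibility Rₐ and friendship ≍_w. -/
structure Frame (W A : Type) : Type where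
  wne : Nonempty W
  ane : Nonempty A
  R : A → W → W → Prop
  friend : W → A → A → Prop

/-- A model: a frame with a valuation; nominals denote unique agents via `Vn`
    (this builds in V(n) = W × {n̲}). -/
structure Model (W A : Type) extends Frame W A where
  Vp : ℕ → W → A → Prop
  Vn : ℕ → A

section Semantics
variable {W A : Type}

/-- Two-dimensional satisfaction M,(w,a) ⊨ φ. -/
def Sat (M : Model W A) : W → A → Form → Prop
  | _, a, .nom n => M.Vn n = a
  | w, a, .pv p => M.Vp p w a
  | _, _, .bot => False
  | w, a, .imp φ ψ => Sat M w a φ → Sat M w a ψ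
  | w, _, .atf n φ => Sat M w (M.Vn n) φ
  | w, a, .fr φ => ∀ b, M.friend w a b → Sat M w b φ
  | w, a, .box φ => ∀ v, M.R a w v → Sat M v a φ

/-- f is a T-assignment: it respects the n-child edges of T. -/
def IsAssign (M : Model W A) (T : Finset Label) (f : Label → W) : Prop :=
  ∀ α n i, Label.child α n i ∈ T → M.R (M.Vn n) (f α) (f (Label.child α n i))

/-- Truth of a labelled formula α:@ₙφ at (M,f); for @-prefixed formulas
    the agent coordinate is irrelevant. -/
def LSat (M : Model W A) (f : Label → W) (l : LForm) : Prop :=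
  ∀ a : A, Sat M (f l.1) a l.2

/-- Truth of a tree sequent Γ ⇒ᵀ Δ at (M,f). -/
def SeqTrue (M : Model W A) (f : Label → W) (Γ Δ : Finset LForm) : Prop :=
  (∀ l ∈ Γ, LSat M f l) → ∃ l ∈ Δ, LSat M f l

end Semantics

/-- Nominal m is fresh in the sequent Γ ⇒ᵀ Δ. -/
def FreshNom (m : ℕ) (T : Finset Label) (Γ Δ : Finset LForm) : Prop :=
  (∀ β ∈ T, m ∉ Label.noms β) ∧
    (∀ l ∈ Γ, m ∉ Label.noms l.1 ∧ m ∉ Form.noms l.2) ∧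
    (∀ l ∈ Δ, m ∉ Label.noms l.1 ∧ m ∉ Form.noms l.2)

/-- Natural number i is fresh in the sequent Γ ⇒ᵀ Δ. -/
def FreshNat (i : ℕ) (T : Finset Label) (Γ Δ : Finset LForm) : Prop :=
  (∀ β ∈ T, i ∉ Label.nats β) ∧
    (∀ l ∈ Γ, i ∉ Label.nats l.1) ∧ (∀ l ∈ Δ, i ∉ Label.nats l.1)

/-- Tree-sequent derivations of height ≤ h.  `Deriv true` is TEFL (with Cut),
    `Deriv false` is TEFL⁻ (without Cut). -/
inductive Deriv (c : Bool) : Finset Label → Finset LForm → Finset LForm → ℕ → Prop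
  | bot {T : Finset Label} {Γ Δ : Finset LForm} (α : Label) (n : ℕ) :
      Deriv c T (insert (α, Form.atf n Form.bot) Γ) Δ 0
  | id {T : Finset Label} {Γ Δ : Finset LForm} (α : Label) (n : ℕ) (φ : Form) :
      Deriv c T (insert (α, Form.atf n φ) Γ) (insert (α, Form.atf n φ) Δ) 0
  | rep1 {T : Finset Label} {Γ Δ : Finset LForm} {h : ℕ} (α : Label) (n m k : ℕ) (φ : Form) :
      Deriv c T (insert (α, Form.atf n (Form.nom m)) (insert (α, Form.sub n k φ) Γ)) Δ h →
      Deriv c T (insert (α, Form.atf n (Form.nom m)) (insert (α, Form.sub m k φ) Γ)) Δ (h+1)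
  | rep2 {T : Finset Label} {Γ Δ : Finset LForm} {h : ℕ} (α : Label) (n m k : ℕ) (φ : Form) :
      Deriv c T (insert (α, Form.atf n (Form.nom m)) (insert (α, Form.sub m k φ) Γ)) Δ h →
      Deriv c T (insert (α, Form.atf n (Form.nom m)) (insert (α, Form.sub n k φ) Γ)) Δ (h+1)
  | refl {T : Finset Label} {Γ Δ : Finset LForm} {h : ℕ} (α : Label) (n : ℕ) :
      α ∈ T →
      Deriv c T (insert (α, Form.atf n (Form.nom n)) Γ) Δ h →
      Deriv c T Γ Δ (h+1)
  | rigid {T : Finset Label} {Γ Δ : Finset LForm} {h : ℕ} (α β : Label) (n m : ℕ) :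
      β ∈ T →
      Deriv c T (insert (β, Form.atf n (Form.nom m)) Γ) Δ h →
      Deriv c T (insert (α, Form.atf n (Form.nom m)) Γ) Δ (h+1)
  | impR {T : Finset Label} {Γ Δ : Finset LForm} {h : ℕ} (α : Label) (n : ℕ) (φ ψ : Form) :
      Deriv c T (insert (α, Form.atf n φ) Γ) (insert (α, Form.atf n ψ) Δ) h →
      Deriv c T Γ (insert (α, Form.atf n (Form.imp φ ψ)) Δ) (h+1)
  | impL {T : Finset Label} {Γ Δ : Finset LForm} {h₁ h₂ : ℕ} (α : Label) (n : ℕ) (φ ψ : Form) :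
      Deriv c T Γ (insert (α, Form.atf n φ) Δ) h₁ →
      Deriv c T (insert (α, Form.atf n ψ) Γ) Δ h₂ →
      Deriv c T (insert (α, Form.atf n (Form.imp φ ψ)) Γ) Δ (max h₁ h₂ + 1)
  | atR {T : Finset Label} {Γ Δ : Finset LForm} {h : ℕ} (α : Label) (n m : ℕ) (φ : Form) :
      Deriv c T Γ (insert (α, Form.atf m φ) Δ) h →
      Deriv c T Γ (insert (α, Form.atf n (Form.atf m φ)) Δ) (h+1)
  | atL {T : Finset Label} {Γ Δ : Finset LForm} {h : ℕ} (α : Label) (n m : ℕ) (φ : Form) :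
      Deriv c T (insert (α, Form.atf m φ) Γ) Δ h →
      Deriv c T (insert (α, Form.atf n (Form.atf m φ)) Γ) Δ (h+1)
  | frR {T : Finset Label} {Γ Δ : Finset LForm} {h : ℕ} (α : Label) (n m : ℕ) (φ : Form) :
      FreshNom m T Γ (insert (α, Form.atf n (Form.fr φ)) Δ) →
      Deriv c T (insert (α, Form.atf n (Form.diaF (Form.nom m))) Γ)
        (insert (α, Form.atf m φ) Δ) h →
      Deriv c T Γ (insert (α, Form.atf n (Form.fr φ)) Δ) (h+1)
  | frL {T : Finset Label} {Γ Δ : Finset LForm} {h₁ h₂ : ℕ} (α : Label) (n m : ℕ) (φ : Form) :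
      Deriv c T Γ (insert (α, Form.atf n (Form.diaF (Form.nom m))) Δ) h₁ →
      Deriv c T (insert (α, Form.atf m φ) Γ) Δ h₂ →
      Deriv c T (insert (α, Form.atf n (Form.fr φ)) Γ) Δ (max h₁ h₂ + 1)
  | boxR {T : Finset Label} {Γ Δ : Finset LForm} {h : ℕ} (α : Label) (n i : ℕ) (φ : Form) :
      FreshNat i T Γ (insert (α, Form.atf n (Form.box φ)) Δ) →
      Deriv c (insert (Label.child α n i) T) Γ
        (insert (Label.child α n i, Form.atf n φ) Δ) h →
      Deriv c T Γ (insert (α, Form.atf n (Form.box φ)) Δ) (h+1)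
  | boxL {T : Finset Label} {Γ Δ : Finset LForm} {h : ℕ} (α : Label) (n i : ℕ) (φ : Form) :
      Label.child α n i ∈ T →
      Deriv c T (insert (Label.child α n i, Form.atf n φ) Γ) Δ h →
      Deriv c T (insert (α, Form.atf n (Form.box φ)) Γ) Δ (h+1)
  | wlab {T : Finset Label} {Γ Δ : Finset LForm} {h : ℕ} (α : Label) :
      IsTree (insert α T) →
      Deriv c T Γ Δ h →
      Deriv c (insert α T) Γ Δ (h+1)
  | cut {T : Finset Label} {Γ Δ P S : Finset LForm} {h₁ h₂ : ℕ} (α : Label) (n : ℕ) (φ : Form) :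
      c = true → α ∈ T →
      Deriv c T Γ (insert (α, Form.atf n φ) Δ) h₁ →
      Deriv c T (insert (α, Form.atf n φ) P) S h₂ →
      Deriv c T (Γ ∪ P) (Δ ∪ S) (max h₁ h₂ + 1)

/-- Provability of a finite tree sequent (`true` = TEFL, `false` = TEFL⁻). -/
def Provable (c : Bool) (T : Finset Label) (Γ Δ : Finset LForm) : Prop :=
  ∃ h : ℕ, Deriv c T Γ Δ h

/-- Provability of a possibly infinite tree sequent in TEFL⁻ :
    some finite subsequent over a finite subtree is provable. -/
def InfProvable (T : Set Label) (Γ Δ : Set LForm) : Prop :=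
  ∃ (T' : Finset Label) (Γ' Δ' : Finset LForm),
    ↑T' ⊆ T ∧ IsTree T' ∧ ↑Γ' ⊆ Γ ∧ ↑Δ' ⊆ Δ ∧ Provable false T' Γ' Δ'

/-- Saturation conditions for a possibly infinite tree sequent. -/
structure Saturated (T : Set Label) (Γ Δ : Set LForm) : Prop where
  rep1 : ∀ (α : Label) (n m k : ℕ) (φ : Form),
    (α, Form.atf n (Form.nom m)) ∈ Γ → (α, Form.sub n k φ) ∈ Γ → (α, Form.sub m k φ) ∈ Γ
  rep2 : ∀ (α : Label) (n m k : ℕ) (φ : Form),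
    (α, Form.atf m (Form.nom n)) ∈ Γ → (α, Form.sub n k φ) ∈ Γ → (α, Form.sub m k φ) ∈ Γ
  refl : ∀ α ∈ T, ∀ n : ℕ, (α, Form.atf n (Form.nom n)) ∈ Γ
  rigid : ∀ (α β : Label) (n m : ℕ), β ∈ T →
    (α, Form.atf n (Form.nom m)) ∈ Γ → (β, Form.atf n (Form.nom m)) ∈ Γ
  impR : ∀ (α : Label) (n : ℕ) (φ ψ : Form), (α, Form.atf n (Form.imp φ ψ)) ∈ Δ →
    (α, Form.atf n φ) ∈ Γ ∧ (α, Form.atf n ψ) ∈ Δ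
  impL : ∀ (α : Label) (n : ℕ) (φ ψ : Form), (α, Form.atf n (Form.imp φ ψ)) ∈ Γ →
    (α, Form.atf n φ) ∈ Δ ∨ (α, Form.atf n ψ) ∈ Γ
  atR : ∀ (α : Label) (n m : ℕ) (φ : Form), (α, Form.atf n (Form.atf m φ)) ∈ Δ →
    (α, Form.atf m φ) ∈ Δ
  atL : ∀ (α : Label) (n m : ℕ) (φ : Form), (α, Form.atf n (Form.atf m φ)) ∈ Γ →
    (α, Form.atf m φ) ∈ Γ
  frR : ∀ (α : Label) (n : ℕ) (φ : Form), (α, Form.atf n (Form.fr φ)) ∈ Δ →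
    ∃ m : ℕ, (α, Form.atf n (Form.diaF (Form.nom m))) ∈ Γ ∧ (α, Form.atf m φ) ∈ Δ
  frL : ∀ (α : Label) (n : ℕ) (φ : Form), (α, Form.atf n (Form.fr φ)) ∈ Γ →
    ∀ m : ℕ, (α, Form.atf n (Form.diaF (Form.nom m))) ∈ Δ ∨ (α, Form.atf m φ) ∈ Γ
  boxR : ∀ (α : Label) (n : ℕ) (φ : Form), (α, Form.atf n (Form.box φ)) ∈ Δ →
    ∃ i : ℕ, Label.child α n i ∈ T ∧ (Label.child α n i, Form.atf n φ) ∈ Δ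
  boxL : ∀ (α : Label) (n : ℕ) (φ : Form), (α, Form.atf n (Form.box φ)) ∈ Γ →
    ∀ i : ℕ, Label.child α n i ∈ T → (Label.child α n i, Form.atf n φ) ∈ Γ

/-- n ~ m iff α:@ₙm ∈ Γ for some α ∈ T. -/
def nrel (T : Set Label) (Γ : Set LForm) (n m : ℕ) : Prop :=
  ∃ α ∈ T, (α, Form.atf n (Form.nom m)) ∈ Γ

/-- Propositional tautology (instance): true under every boolean valuation
    respecting ⊥ and →. -/
def IsTaut (φ : Form) : Prop :=
  ∀ v : Form → Bool, v Form.bot = false →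
    (∀ ψ χ : Form, v (Form.imp ψ χ) = (!(v ψ) || v χ)) → v φ = true

/-- Uniform substitution: propositional variables by formulas, nominals by nominals. -/
def ApplySub (σp : ℕ → Form) (σn : ℕ → ℕ) : Form → Form
  | .nom n => .nom (σn n)
  | .pv p => σp p
  | .bot => .bot
  | .imp φ ψ => .imp (ApplySub σp σn φ) (ApplySub σp σn ψ)
  | .atf n φ => .atf (σn n) (ApplySub σp σn φ)
  | .fr φ => .fr (ApplySub σp σn φ)
  | .box φ => .box (ApplySub σp σn φ)

/-- Necessity forms L ::= # | ψ→L | @ₙ□L. -/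
inductive NForm : Type
  | hole : NForm
  | imp : Form → NForm → NForm
  | atBox : ℕ → NForm → NForm

/-- L(χ): replace the unique occurrence of # in L by χ. -/
def NForm.fill : NForm → Form → Form
  | .hole, χ => χ
  | .imp ψ L, χ => Form.imp ψ (NForm.fill L χ)
  | .atBox n L, χ => Form.atf n (Form.box (NForm.fill L χ))

/-- The Hilbert system HEFL, extended by an extra set `ax` of axioms
    (HEFL itself is `Hil ∅`). -/
inductive Hil (ax : Set Form) : Form → Prop
  | extra {φ : Form} : φ ∈ ax → Hil ax φ
  | taut {φ : Form} : IsTaut φ → Hil ax φ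
  | kBox (p q : ℕ) : Hil ax (Form.imp (Form.box (Form.imp (Form.pv p) (Form.pv q)))
      (Form.imp (Form.box (Form.pv p)) (Form.box (Form.pv q))))
  | kF (p q : ℕ) : Hil ax (Form.imp (Form.fr (Form.imp (Form.pv p) (Form.pv q)))
      (Form.imp (Form.fr (Form.pv p)) (Form.fr (Form.pv q))))
  | kAt (n p q : ℕ) : Hil ax (Form.imp (Form.atf n (Form.imp (Form.pv p) (Form.pv q)))
      (Form.imp (Form.atf n (Form.pv p)) (Form.atf n (Form.pv q))))
  | refAx (n : ℕ) : Hil ax (Form.atf n (Form.nom n))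
  | selfdual (n p : ℕ) : Hil ax (Form.iff (Form.neg (Form.atf n (Form.pv p)))
      (Form.atf n (Form.neg (Form.pv p))))
  | elim (n p : ℕ) : Hil ax (Form.imp (Form.atf n (Form.pv p))
      (Form.imp (Form.nom n) (Form.pv p)))
  | agree (n m p : ℕ) : Hil ax (Form.imp (Form.atf n (Form.atf m (Form.pv p)))
      (Form.atf m (Form.pv p)))
  | back (n p : ℕ) : Hil ax (Form.imp (Form.atf n (Form.pv p))
      (Form.fr (Form.atf n (Form.pv p))))
  | dcom (n p : ℕ) : Hil ax (Form.iff (Form.atf n (Form.box (Form.atf n (Form.pv p))))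
      (Form.atf n (Form.box (Form.pv p))))
  | rigidEq (n m : ℕ) : Hil ax (Form.imp (Form.atf n (Form.nom m))
      (Form.box (Form.atf n (Form.nom m))))
  | rigidNeq (n m : ℕ) : Hil ax (Form.imp (Form.neg (Form.atf n (Form.nom m)))
      (Form.box (Form.neg (Form.atf n (Form.nom m)))))
  | mp {φ ψ : Form} : Hil ax (Form.imp φ ψ) → Hil ax φ → Hil ax ψ
  | necBox {φ : Form} : Hil ax φ → Hil ax (Form.box φ)
  | necF {φ : Form} : Hil ax φ → Hil ax (Form.fr φ)
  | necAt {φ : Form} (n : ℕ) : Hil ax φ → Hil ax (Form.atf n φ)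
  | us {φ : Form} (σp : ℕ → Form) (σn : ℕ → ℕ) : Hil ax φ → Hil ax (ApplySub σp σn φ)
  | name {φ : Form} (n : ℕ) : n ∉ Form.noms φ →
      Hil ax (Form.imp (Form.nom n) φ) → Hil ax φ
  | lbg {φ : Form} (L : NForm) (n m : ℕ) :
      m ∉ Form.noms (NForm.fill L (Form.atf n (Form.fr φ))) →
      Hil ax (NForm.fill L (Form.imp (Form.atf n (Form.diaF (Form.nom m))) (Form.atf m φ))) →
      Hil ax (NForm.fill L (Form.atf n (Form.fr φ)))

/-- finite conjunction (empty = ⊤) -/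
def conjList : List Form → Form
  | [] => Form.top
  | φ :: l => Form.and φ (conjList l)

/-- finite disjunction (empty = ⊥) -/
def disjList : List Form → Form
  | [] => Form.bot
  | φ :: l => Form.or φ (disjList l)

/-- Formulaic translation, with a fuel parameter bounding the recursion depth. -/
noncomputable def translAux : ℕ → Finset Label → Finset LForm → Finset LForm → Label → Form
  | 0, _, _, _, _ => Form.bot
  | d+1, T, Γ, Δ, α =>
    Form.imp (conjList ((Γ.filter (fun l => l.1 = α)).toList.map Prod.snd))
      (disjList (((Δ.filter (fun l => l.1 = α)).toList.map Prod.snd) ++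
        (T.toList.filterMap (fun β =>
          match β with
          | Label.child γ n i =>
            if γ = α then
              some (Form.atf n (Form.box (translAux d T Γ Δ (Label.child γ n i))))
            else none
          | Label.root _ => none))))

/-- ⟦Γ ⇒ᵀ Δ⟧_α : the formulaic translation of a tree sequent at label α. -/
noncomputable def transl (T : Finset Label) (Γ Δ : Finset LForm) (α : Label) : Form :=
  translAux (T.card + 1) T Γ Δ α

section FrameValidity
variable {W A : Type}

/-- A formula is valid in a frame: true under every valuation at every pair. -/
def FrameValid (F : Frame W A) (φ : Form) : Prop :=
  ∀ (Vp : ℕ → W → A → Prop) (Vn : ℕ → A) (w : W) (a : A),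
    Sat { toFrame := F, Vp := Vp, Vn := Vn } w a φ

end FrameValidity

/-- Formulas of the shape @ₙm or @ₙ⟨F⟩m. -/
def IsRho (φ : Form) : Prop :=
  (∃ n m : ℕ, φ = Form.atf n (Form.nom m)) ∨
    (∃ n m : ℕ, φ = Form.atf n (Form.diaF (Form.nom m)))

/-- Regular implications (ρ₁ ∧ … ∧ ρ_h) → (ρ₁' ∨ … ∨ ρ_l'). -/
def IsRegImp (φ : Form) : Prop :=
  ∃ l₁ l₂ : List Form, (∀ ρ ∈ l₁, IsRho ρ) ∧ (∀ ρ ∈ l₂, IsRho ρ) ∧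
    φ = Form.imp (conjList l₁) (disjList l₂)

/-- S4 := {□p→p, □p→□□p}. -/
def S4Ax : Set Form :=
  {Form.imp (Form.box (Form.pv 0)) (Form.pv 0),
   Form.imp (Form.box (Form.pv 0)) (Form.box (Form.box (Form.pv 0)))}

/-- S5 := S4 ∪ {p→□¬□¬p}. -/
def S5Ax : Set Form :=
  S4Ax ∪ {Form.imp (Form.pv 0)
    (Form.box (Form.neg (Form.box (Form.neg (Form.pv 0)))))}

section Soundness
variable {W A : Type}

theorem lSat_atf (M : Model W A) (f : Label → W) (α : Label) (n : ℕ) (φ : Form) :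
    LSat M f (α, Form.atf n φ) ↔ Sat M (f α) (M.Vn n) φ :=
  ⟨fun h => h (M.Vn n), fun h _ => h⟩

theorem sat_diaF_nom (M : Model W A) (w : W) (a : A) (m : ℕ) :
    Sat M w a (Form.diaF (Form.nom m)) ↔ M.friend w a (M.Vn m) := by
  simp [Form.diaF, Form.neg, Sat]

/-- Substituting either of two nominals with the same denotation yields equivalent formulas. -/
theorem sat_sub_congr (M : Model W A) {n m : ℕ} (h : M.Vn n = M.Vn m) (k : ℕ) (φ : Form) :
    ∀ w a, Sat M w a (Form.sub n k φ) ↔ Sat M w a (Form.sub m k φ) := by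
  induction φ with
  | nom j => intro w a; by_cases hj : j = k <;> simp [Form.sub, hj, Sat, h]
  | pv p => intro w a; rfl
  | bot => intro w a; rfl
  | imp φ ψ ihφ ihψ => intro w a; simp [Form.sub, Sat, ihφ, ihψ]
  | atf j φ ih => intro w a; by_cases hj : j = k <;> simp [Form.sub, hj, Sat, h, ih]
  | fr φ ih => intro w a; simp [Form.sub, Sat, ih]
  | box φ ih => intro w a; simp [Form.sub, Sat, ih]

theorem lSat_sub_congr (M : Model W A) (f : Label → W) {n m : ℕ} (h : M.Vn n = M.Vn m)
    (α : Label) (k : ℕ) (φ : Form) :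
    LSat M f (α, Form.sub n k φ) ↔ LSat M f (α, Form.sub m k φ) :=
  forall_congr' fun a => sat_sub_congr M h k φ (f α) a

/-- The model obtained from `M` by letting the nominal `m` denote the agent `b`. -/
def Model.updateNom (M : Model W A) (m : ℕ) (b : A) : Model W A :=
  { M with Vn := Function.update M.Vn m b }

theorem Model.updateNom_vn_self (M : Model W A) (m : ℕ) (b : A) :
    (M.updateNom m b).Vn m = b := by
  simp [Model.updateNom]

theorem Model.updateNom_vn_of_ne (M : Model W A) {m n : ℕ} (b : A) (h : n ≠ m) :
    (M.updateNom m b).Vn n = M.Vn n := by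
  simp [Model.updateNom, h]

theorem sat_updateNom (M : Model W A) (m : ℕ) (b : A) (φ : Form) (hm : m ∉ Form.noms φ) :
    ∀ w a, Sat (M.updateNom m b) w a φ ↔ Sat M w a φ := by
  induction φ with
  | nom j =>
    intro w a
    have hj : j ≠ m := fun e => hm (by simp [Form.noms, e])
    simp [Sat, M.updateNom_vn_of_ne b hj]
  | pv p => intro w a; rfl
  | bot => intro w a; rfl
  | imp φ ψ ihφ ihψ =>
    intro w a
    simp only [Form.noms, Finset.mem_union, not_or] at hm
    simp [Sat, ihφ hm.1, ihψ hm.2]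
  | atf j φ ih =>
    intro w a
    simp only [Form.noms, Finset.mem_insert, not_or] at hm
    simp [Sat, M.updateNom_vn_of_ne b (Ne.symm hm.1), ih hm.2]
  | fr φ ih =>
    intro w a
    exact forall_congr' fun c => imp_congr_right fun _ => ih hm w c
  | box φ ih =>
    intro w a
    exact forall_congr' fun v => imp_congr_right fun _ => ih hm v a

theorem isAssign_updateNom {M : Model W A} {T : Finset Label} {f : Label → W} {m : ℕ}
    (hm : ∀ β ∈ T, m ∉ Label.noms β) (b : A) (hf : IsAssign M T f) :
    IsAssign (M.updateNom m b) T f := by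
  intro α n i hα
  have hn : n ≠ m := fun e => hm _ hα (by simp [Label.noms, e])
  rw [M.updateNom_vn_of_ne b hn]
  exact hf α n i hα

theorem lSat_update_of_ne (M : Model W A) (f : Label → W) {β : Label} (v : W) {l : LForm}
    (h : l.1 ≠ β) : LSat M (Function.update f β v) l ↔ LSat M f l := by
  simp [LSat, Function.update_of_ne h]

theorem Label.mem_nats_child (α : Label) (n i : ℕ) : i ∈ Label.nats (Label.child α n i) := by
  simp [Label.nats]

theorem Label.ne_child_of_notMem_nats {β : Label} {i : ℕ} (h : i ∉ Label.nats β)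
    (α : Label) (n : ℕ) : β ≠ Label.child α n i :=
  fun e => h (e ▸ Label.mem_nats_child α n i)

/-- An assignment extends to a fresh child of `α` by any successor of the state of `α`. -/
theorem isAssign_update_child {M : Model W A} {T : Finset Label} {f : Label → W} {α : Label}
    {n i : ℕ} {v : W} (hT : ∀ β ∈ T, i ∉ Label.nats β) (hα : i ∉ Label.nats α)
    (hv : M.R (M.Vn n) (f α) v) (hf : IsAssign M T f) :
    IsAssign M (insert (Label.child α n i) T) (Function.update f (Label.child α n i) v) := by
  intro β k j hβ
  rcases Finset.mem_insert.1 hβ with e | hβ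
  · injection e with e₁ e₂ e₃
    subst e₁ e₂ e₃
    rw [Function.update_of_ne (Label.ne_child_of_notMem_nats hα β k), Function.update_self]
    exact hv
  · have hi := hT _ hβ
    have hi' : i ∉ Label.nats β := fun h => hi (by simp [Label.nats, h])
    rw [Function.update_of_ne (Label.ne_child_of_notMem_nats hi' α n),
      Function.update_of_ne (Label.ne_child_of_notMem_nats hi α n)]
    exact hf β k j hβ

/-- Every derivable sequent is true under every assignment; the labels of its formulas need
not even lie in the tree. -/
theorem Deriv.seqTrue {c : Bool} {T : Finset Label} {Γ Δ : Finset LForm} {h : ℕ}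
    (d : Deriv c T Γ Δ h) :
    ∀ (M : Model W A) (f : Label → W), IsAssign M T f → SeqTrue M f Γ Δ := by
  induction d with
  | bot α n =>
    intro M f _ hΓ
    exact ((lSat_atf M f α n _).1 (hΓ _ (Finset.mem_insert_self _ _))).elim
  | id α n φ =>
    intro M f _ hΓ
    exact ⟨_, Finset.mem_insert_self _ _, hΓ _ (Finset.mem_insert_self _ _)⟩
  | rep1 α n m k φ _ ih =>
    intro M f hf hΓ
    have ih := ih M f hf
    simp only [SeqTrue, Finset.forall_mem_insert] at ih hΓ
    have e : M.Vn m = M.Vn n := (lSat_atf M f α n _).1 hΓ.1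
    exact ih ⟨hΓ.1, (lSat_sub_congr M f e α k φ).1 hΓ.2.1, hΓ.2.2⟩
  | rep2 α n m k φ _ ih =>
    intro M f hf hΓ
    have ih := ih M f hf
    simp only [SeqTrue, Finset.forall_mem_insert] at ih hΓ
    have e : M.Vn m = M.Vn n := (lSat_atf M f α n _).1 hΓ.1
    exact ih ⟨hΓ.1, (lSat_sub_congr M f e α k φ).2 hΓ.2.1, hΓ.2.2⟩
  | refl α n _ _ ih =>
    intro M f hf hΓ
    exact ih M f hf (Finset.forall_mem_insert _ _ _ |>.2 ⟨fun _ => rfl, hΓ⟩)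
  | rigid α β n m _ _ ih =>
    intro M f hf hΓ
    rw [Finset.forall_mem_insert] at hΓ
    exact ih M f hf (Finset.forall_mem_insert _ _ _ |>.2 hΓ)
  | impR α n φ ψ _ ih =>
    intro M f hf hΓ
    have ih := ih M f hf
    simp only [SeqTrue, Finset.forall_mem_insert, Finset.exists_mem_insert, lSat_atf, Sat]
      at ih ⊢
    tauto
  | impL α n φ ψ _ _ ih₁ ih₂ =>
    intro M f hf hΓ
    have ih₁ := ih₁ M f hf
    have ih₂ := ih₂ M f hf
    simp only [SeqTrue, Finset.forall_mem_insert, Finset.exists_mem_insert, lSat_atf, Sat]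
      at ih₁ ih₂ hΓ
    tauto
  | atR α n m φ _ ih =>
    intro M f hf hΓ
    simpa only [Finset.exists_mem_insert, lSat_atf, Sat] using ih M f hf hΓ
  | atL α n m φ _ ih =>
    intro M f hf hΓ
    have ih := ih M f hf
    simp only [SeqTrue, Finset.forall_mem_insert, lSat_atf, Sat] at ih hΓ
    exact ih hΓ
  | @frR T Γ Δ h α n m φ hfresh _ ih =>
    intro M f hf hΓ
    obtain ⟨hmT, hmΓ, hmΔ⟩ := hfresh
    rw [Finset.forall_mem_insert] at hmΔ
    obtain ⟨⟨-, hm⟩, hmΔ⟩ := hmΔ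
    simp only [Form.noms, Finset.mem_insert, not_or] at hm
    rw [Finset.exists_mem_insert, lSat_atf]
    by_contra! hcon
    obtain ⟨hfr, hΔ⟩ := hcon
    simp only [Sat, not_forall] at hfr
    obtain ⟨b, hb, hφ⟩ := hfr
    have ih := ih (M.updateNom m b) f (isAssign_updateNom hmT b hf)
    simp only [SeqTrue, Finset.forall_mem_insert, Finset.exists_mem_insert, lSat_atf,
      sat_diaF_nom, M.updateNom_vn_self, M.updateNom_vn_of_ne b (Ne.symm hm.1),
      sat_updateNom M m b φ hm.2] at ih
    have key : ∀ l : LForm, m ∉ Form.noms l.2 → (LSat (M.updateNom m b) f l ↔ LSat M f l) :=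
      fun l hl => forall_congr' fun a => sat_updateNom M m b l.2 hl (f l.1) a
    rcases ih ⟨hb, fun l hl => (key l (hmΓ l hl).2).2 (hΓ l hl)⟩ with h | ⟨l, hl, h⟩
    · exact hφ h
    · exact hΔ l hl ((key l (hmΔ l hl).2).1 h)
  | frL α n m φ _ _ ih₁ ih₂ =>
    intro M f hf hΓ
    have ih₁ := ih₁ M f hf
    have ih₂ := ih₂ M f hf
    simp only [SeqTrue, Finset.forall_mem_insert, Finset.exists_mem_insert, lSat_atf,
      sat_diaF_nom] at ih₁ ih₂ hΓ
    rcases ih₁ hΓ.2 with h | h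
    · exact ih₂ ⟨hΓ.1 _ h, hΓ.2⟩
    · exact h
  | @boxR T Γ Δ h α n i φ hfresh _ ih =>
    intro M f hf hΓ
    obtain ⟨hiT, hiΓ, hiΔ⟩ := hfresh
    rw [Finset.forall_mem_insert] at hiΔ
    obtain ⟨hiα, hiΔ⟩ := hiΔ
    rw [Finset.exists_mem_insert, lSat_atf]
    by_contra! hcon
    obtain ⟨hbox, hΔ⟩ := hcon
    simp only [Sat, not_forall] at hbox
    obtain ⟨v, hv, hφ⟩ := hbox
    have key : ∀ l : LForm, i ∉ Label.nats l.1 →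
        (LSat M (Function.update f (Label.child α n i) v) l ↔ LSat M f l) :=
      fun l hl => lSat_update_of_ne M f v (Label.ne_child_of_notMem_nats hl α n)
    have ih := ih M _ (isAssign_update_child hiT hiα hv hf)
      fun l hl => (key l (hiΓ l hl)).2 (hΓ l hl)
    rw [Finset.exists_mem_insert, lSat_atf, Function.update_self] at ih
    rcases ih with h | ⟨l, hl, h⟩
    · exact hφ h
    · exact hΔ l hl ((key l (hiΔ l hl)).1 h)
  | boxL α n i φ hT _ ih =>
    intro M f hf hΓ
    have ih := ih M f hf
    simp only [SeqTrue, Finset.forall_mem_insert, lSat_atf] at ih hΓ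
    exact ih ⟨hΓ.1 _ (hf α n i hT), hΓ.2⟩
  | wlab α _ _ ih =>
    intro M f hf
    exact ih M f fun β n i hβ => hf β n i (Finset.mem_insert_of_mem hβ)
  | cut α n φ _ _ _ _ ih₁ ih₂ =>
    intro M f hf hΓ
    have h₁ := ih₁ M f hf fun l hl => hΓ l (Finset.mem_union_left _ hl)
    rw [Finset.exists_mem_insert] at h₁
    rcases h₁ with h | ⟨l, hl, h⟩
    · obtain ⟨l, hl, h⟩ := ih₂ M f hf (Finset.forall_mem_insert _ _ _ |>.2
        ⟨h, fun l hl => hΓ l (Finset.mem_union_right _ hl)⟩)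
      exact ⟨l, Finset.mem_union_right _ hl, h⟩
    · exact ⟨l, Finset.mem_union_left _ hl, h⟩

end Soundness

/-- Soundness of TEFL. -/
theorem soundness_TEFL (T : Finset Label) (Γ Δ : Finset LForm)
    (hT : IsTree T) (hΓ : ∀ l ∈ Γ, l.1 ∈ T) (hΔ : ∀ l ∈ Δ, l.1 ∈ T)
    (hprov : Provable true T Γ Δ) :
    ∀ (W A : Type) (M : Model W A) (f : Label → W),
      IsAssign M T f → SeqTrue M f Γ Δ := by
  intro W A M f hf
  obtain ⟨h, d⟩ := hprov
  exact d.seqTrue M f hf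
end

section
/- The weakening rules (wR): from Γ ⇒^T Δ infer Γ ⇒^T Δ, α:@_nφ, and (wL): from Γ ⇒^T Δ infer α:@_nφ, Γ ⇒^T Δ (for α ∈ T), are height-preserving admissible in both TEFL⁻ and TEFL: if the premise has a derivation of height at most h, then the conclusion has a derivation of height at most h. -/
set_option autoImplicit false

/-- Rename the edge nominals of a label by `σ` and its natural numbers by `ρ`. -/
def Label.rename (σ ρ : ℕ → ℕ) : Label → Label
  | .root j => .root (ρ j)
  | .child α n i => .child (Label.rename σ ρ α) (σ n) (ρ i)

/-- Rename the nominals of a formula. -/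
def Form.rename (σ : ℕ → ℕ) (φ : Form) : Form := ApplySub Form.pv σ φ

/-- Rename the nominals and natural numbers of a labelled formula. -/
def LForm.rename (σ ρ : ℕ → ℕ) (l : LForm) : LForm := (l.1.rename σ ρ, l.2.rename σ)

theorem Label.rename_congr {σ σ' ρ ρ' : ℕ → ℕ} {α : Label}
    (hσ : ∀ x ∈ α.noms, σ' x = σ x) (hρ : ∀ x ∈ α.nats, ρ' x = ρ x) :
    α.rename σ' ρ' = α.rename σ ρ := by
  induction α <;> simp_all [Label.rename, Label.noms, Label.nats]

theorem Form.rename_congr {σ σ' : ℕ → ℕ} {φ : Form} (hσ : ∀ x ∈ φ.noms, σ' x = σ x) :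
    φ.rename σ' = φ.rename σ := by
  induction φ <;> simp_all [Form.rename, ApplySub, Form.noms]

theorem LForm.rename_congr {σ σ' ρ ρ' : ℕ → ℕ} {l : LForm}
    (hα : ∀ x ∈ l.1.noms, σ' x = σ x) (hφ : ∀ x ∈ l.2.noms, σ' x = σ x)
    (hρ : ∀ x ∈ l.1.nats, ρ' x = ρ x) :
    LForm.rename σ' ρ' l = LForm.rename σ ρ l :=
  Prod.ext (Label.rename_congr hα hρ) (Form.rename_congr hφ)

theorem Label.rename_id (α : Label) : α.rename id id = α := by
  induction α <;> simp_all [Label.rename]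

theorem Form.rename_id (φ : Form) : φ.rename id = φ := by
  induction φ <;> simp_all [Form.rename, ApplySub]

theorem LForm.rename_id (l : LForm) : LForm.rename id id l = l :=
  Prod.ext (Label.rename_id l.1) (Form.rename_id l.2)

theorem Label.mem_noms_rename {σ ρ : ℕ → ℕ} {α : Label} {x : ℕ} (hx : x ∈ α.noms) :
    σ x ∈ (α.rename σ ρ).noms := by
  induction α with
  | root j => simp [Label.noms] at hx
  | child α n i ih =>
    simp only [Label.noms, Label.rename, Finset.mem_insert] at hx ⊢
    exact hx.imp (congrArg σ) ih

theorem Form.mem_noms_rename {σ : ℕ → ℕ} {φ : Form} {x : ℕ} (hx : x ∈ φ.noms) :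
    σ x ∈ (φ.rename σ).noms := by
  induction φ <;> simp_all [Form.noms, Form.rename, ApplySub] <;> grind

theorem Form.rename_sub {σ : ℕ → ℕ} (hσ : σ.Injective) (m k : ℕ) (φ : Form) :
    (Form.sub m k φ).rename σ = Form.sub (σ m) (σ k) (φ.rename σ) := by
  induction φ with
  | nom n => by_cases hn : n = k <;> simp [Form.sub, Form.rename, ApplySub, hn, hσ.eq_iff]
  | atf n φ ih =>
    by_cases hn : n = k <;> simp_all [Form.sub, Form.rename, ApplySub, hσ.eq_iff]
  | _ => simp_all [Form.sub, Form.rename, ApplySub]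

theorem IsTree.rename {T : Finset Label} (hT : IsTree T) (σ ρ : ℕ → ℕ) :
    IsTree (T.image (Label.rename σ ρ)) := by
  obtain ⟨⟨j, hj, huniq⟩, hchild⟩ := hT
  refine ⟨⟨ρ j, Finset.mem_image_of_mem (Label.rename σ ρ) hj, ?_⟩, ?_⟩
  · intro k hk
    obtain ⟨β, hβ, hβk⟩ := Finset.mem_image.1 hk
    cases β with
    | root i =>
      obtain rfl := huniq i hβ
      exact (Label.root.inj hβk).symm
    | child β n i => cases hβk
  · intro α n i hα
    obtain ⟨β, hβ, hβα⟩ := Finset.mem_image.1 hα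
    cases β with
    | root k => cases hβα
    | child β m k =>
      obtain ⟨rfl, -, -⟩ := Label.child.inj hβα
      exact Finset.mem_image_of_mem _ (hchild β m k hβ)

theorem exists_freshNom (T : Finset Label) (Γ Δ : Finset LForm) : ∃ m, FreshNom m T Γ Δ := by
  obtain ⟨m, hm⟩ := Infinite.exists_notMem_finset
    (T.biUnion Label.noms ∪ (Γ ∪ Δ).biUnion fun l => l.1.noms ∪ l.2.noms)
  refine ⟨m, fun β hβ h => hm ?_, fun l hl => ⟨fun h => hm ?_, fun h => hm ?_⟩,
    fun l hl => ⟨fun h => hm ?_, fun h => hm ?_⟩⟩ <;>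
    simp only [Finset.mem_union, Finset.mem_biUnion] <;> grind

theorem exists_freshNat (T : Finset Label) (Γ Δ : Finset LForm) : ∃ i, FreshNat i T Γ Δ := by
  obtain ⟨i, hi⟩ := Infinite.exists_notMem_finset
    (T.biUnion Label.nats ∪ (Γ ∪ Δ).biUnion fun l => l.1.nats)
  refine ⟨i, fun β hβ h => hi ?_, fun l hl h => hi ?_, fun l hl h => hi ?_⟩ <;>
    simp only [Finset.mem_union, Finset.mem_biUnion] <;> grind

theorem LForm.rename_mem_insert {σ ρ : ℕ → ℕ} {Γ Γ' : Finset LForm} (a : LForm)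
    (hΓ : ∀ l ∈ Γ, LForm.rename σ ρ l ∈ Γ') :
    ∀ l ∈ insert a Γ, LForm.rename σ ρ l ∈ insert (LForm.rename σ ρ a) Γ' := by
  grind

/-- Derivations are closed, without change of height, under simultaneously renaming nominals
injectively, renaming natural numbers, and enlarging both sides of the sequent. The renaming is
what lets the eigenvariables of `frR` and `boxR` avoid the added formulas. -/
theorem Deriv.rename_weaken {c : Bool} {T : Finset Label} {Γ Δ : Finset LForm} {h : ℕ}
    (hd : Deriv c T Γ Δ h) {σ : ℕ → ℕ} (hσ : σ.Injective) (ρ : ℕ → ℕ) {Γ' Δ' : Finset LForm}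
    (hΓ : ∀ l ∈ Γ, LForm.rename σ ρ l ∈ Γ') (hΔ : ∀ l ∈ Δ, LForm.rename σ ρ l ∈ Δ') :
    Deriv c (T.image (Label.rename σ ρ)) Γ' Δ' h := by
  induction hd generalizing σ ρ Γ' Δ' with
  | bot α n =>
    rw [← Finset.insert_eq_of_mem (hΓ _ (Finset.mem_insert_self _ _))]
    exact .bot _ _
  | id α n φ =>
    rw [← Finset.insert_eq_of_mem (hΓ _ (Finset.mem_insert_self _ _)),
      ← Finset.insert_eq_of_mem (hΔ _ (Finset.mem_insert_self _ _))]
    exact .id _ _ _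
  | rep1 α n m k φ _ ih =>
    rw [Finset.forall_mem_insert, Finset.forall_mem_insert] at hΓ
    obtain ⟨h₁, h₂, hΓ⟩ := hΓ
    have hd := ih hσ ρ (LForm.rename_mem_insert _ (LForm.rename_mem_insert _ hΓ)) hΔ
    simp only [LForm.rename, Form.rename_sub hσ] at hd h₂
    have := Deriv.rep1 _ _ _ _ _ hd
    rw [Finset.insert_eq_of_mem h₂] at this
    rw [← Finset.insert_eq_of_mem h₁]
    exact this
  | rep2 α n m k φ _ ih =>
    rw [Finset.forall_mem_insert, Finset.forall_mem_insert] at hΓ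
    obtain ⟨h₁, h₂, hΓ⟩ := hΓ
    have hd := ih hσ ρ (LForm.rename_mem_insert _ (LForm.rename_mem_insert _ hΓ)) hΔ
    simp only [LForm.rename, Form.rename_sub hσ] at hd h₂
    have := Deriv.rep2 _ _ _ _ _ hd
    rw [Finset.insert_eq_of_mem h₂] at this
    rw [← Finset.insert_eq_of_mem h₁]
    exact this
  | refl α n hα _ ih =>
    exact .refl _ _ (Finset.mem_image_of_mem _ hα) (ih hσ ρ (LForm.rename_mem_insert _ hΓ) hΔ)
  | rigid α β n m hβ _ ih =>
    rw [Finset.forall_mem_insert] at hΓ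
    rw [← Finset.insert_eq_of_mem hΓ.1]
    exact .rigid _ _ _ _ (Finset.mem_image_of_mem _ hβ)
      (ih hσ ρ (LForm.rename_mem_insert _ hΓ.2) hΔ)
  | impR α n φ ψ _ ih =>
    rw [Finset.forall_mem_insert] at hΔ
    rw [← Finset.insert_eq_of_mem hΔ.1]
    exact .impR _ _ _ _
      (ih hσ ρ (LForm.rename_mem_insert _ hΓ) (LForm.rename_mem_insert _ hΔ.2))
  | impL α n φ ψ _ _ ih₁ ih₂ =>
    rw [Finset.forall_mem_insert] at hΓ
    rw [← Finset.insert_eq_of_mem hΓ.1]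
    exact .impL _ _ _ _ (ih₁ hσ ρ hΓ.2 (LForm.rename_mem_insert _ hΔ))
      (ih₂ hσ ρ (LForm.rename_mem_insert _ hΓ.2) hΔ)
  | atR α n m φ _ ih =>
    rw [Finset.forall_mem_insert] at hΔ
    rw [← Finset.insert_eq_of_mem hΔ.1]
    exact .atR _ _ _ _ (ih hσ ρ hΓ (LForm.rename_mem_insert _ hΔ.2))
  | atL α n m φ _ ih =>
    rw [Finset.forall_mem_insert] at hΓ
    rw [← Finset.insert_eq_of_mem hΓ.1]
    exact .atL _ _ _ _ (ih hσ ρ (LForm.rename_mem_insert _ hΓ.2) hΔ)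
  | @frR T Γ Δ h α n m φ hm _ ih =>
    obtain ⟨m', hm'⟩ := exists_freshNom (T.image (Label.rename σ ρ)) Γ' Δ'
    obtain ⟨hmT, hmΓ, hmΔ⟩ := hm
    have ⟨hT', hΓ', hΔ'⟩ := hm'
    let τ : ℕ → ℕ := Equiv.swap (σ m) m' ∘ σ
    have hτ : τ.Injective := (Equiv.injective _).comp hσ
    have hτm : τ m = m' := Equiv.swap_apply_left _ _
    have hτσ {S : Finset ℕ} (h₁ : m ∉ S) (h₂ : ∀ x ∈ S, σ x ≠ m') : ∀ x ∈ S, τ x = σ x :=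
      fun x hx => Equiv.swap_apply_of_ne_of_ne (fun h => h₁ (hσ h ▸ hx)) (h₂ x hx)
    have rename_eq {l : LForm} (hl : m ∉ l.1.noms ∧ m ∉ l.2.noms)
        (hl' : m' ∉ (LForm.rename σ ρ l).1.noms ∧ m' ∉ (LForm.rename σ ρ l).2.noms) :
        LForm.rename τ ρ l = LForm.rename σ ρ l :=
      LForm.rename_congr
        (hτσ hl.1 fun x hx h => hl'.1 (h ▸ Label.mem_noms_rename hx))
        (hτσ hl.2 fun x hx h => hl'.2 (h ▸ Form.mem_noms_rename hx)) fun _ _ => rfl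
    have hTτ : T.image (Label.rename τ ρ) = T.image (Label.rename σ ρ) :=
      Finset.image_congr fun β hβ => Label.rename_congr
        (hτσ (hmT β hβ) fun x hx h =>
          hT' _ (Finset.mem_image_of_mem _ hβ) (h ▸ Label.mem_noms_rename hx)) fun _ _ => rfl
    have hΓτ : ∀ l ∈ Γ, LForm.rename τ ρ l ∈ Γ' := fun l hl =>
      rename_eq (hmΓ l hl) (hΓ' _ (hΓ l hl)) ▸ hΓ l hl
    have hΔτ : ∀ l ∈ insert (α, Form.atf n (Form.fr φ)) Δ, LForm.rename τ ρ l ∈ Δ' :=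
      fun l hl => rename_eq (hmΔ l hl) (hΔ' _ (hΔ l hl)) ▸ hΔ l hl
    rw [Finset.forall_mem_insert] at hΔτ
    have hd := ih hτ ρ (LForm.rename_mem_insert _ hΓτ) (LForm.rename_mem_insert _ hΔτ.2)
    rw [hTτ] at hd
    have hins := Finset.insert_eq_of_mem hΔτ.1
    rw [← hins]
    refine .frR _ _ m' _ (hins.symm ▸ hm') ?_
    rw [← hτm]
    exact hd
  | frL α n m φ _ _ ih₁ ih₂ =>
    rw [Finset.forall_mem_insert] at hΓ
    rw [← Finset.insert_eq_of_mem hΓ.1]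
    exact .frL _ _ (σ m) _ (ih₁ hσ ρ hΓ.2 (LForm.rename_mem_insert _ hΔ))
      (ih₂ hσ ρ (LForm.rename_mem_insert _ hΓ.2) hΔ)
  | @boxR T Γ Δ h α n i φ hi _ ih =>
    obtain ⟨j, hj⟩ := exists_freshNat (T.image (Label.rename σ ρ)) Γ' Δ'
    obtain ⟨hiT, hiΓ, hiΔ⟩ := hi
    let τ : ℕ → ℕ := Function.update ρ i j
    have hτi : τ i = j := Function.update_self _ _ _
    have hτρ {S : Finset ℕ} (hS : i ∉ S) : ∀ x ∈ S, τ x = ρ x :=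
      fun x hx => Function.update_of_ne (by rintro rfl; exact hS hx) _ _
    have rename_eq {l : LForm} (hl : i ∉ l.1.nats) : LForm.rename σ τ l = LForm.rename σ ρ l :=
      LForm.rename_congr (fun _ _ => rfl) (fun _ _ => rfl) (hτρ hl)
    have hTτ : T.image (Label.rename σ τ) = T.image (Label.rename σ ρ) :=
      Finset.image_congr fun β hβ => Label.rename_congr (fun _ _ => rfl) (hτρ (hiT β hβ))
    have hΓτ : ∀ l ∈ Γ, LForm.rename σ τ l ∈ Γ' := fun l hl =>
      rename_eq (hiΓ l hl) ▸ hΓ l hl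
    have hΔτ : ∀ l ∈ insert (α, Form.atf n (Form.box φ)) Δ, LForm.rename σ τ l ∈ Δ' :=
      fun l hl => rename_eq (hiΔ l hl) ▸ hΔ l hl
    rw [Finset.forall_mem_insert] at hΔτ
    have hd := ih hσ τ hΓτ (LForm.rename_mem_insert _ hΔτ.2)
    rw [Finset.image_insert, hTτ] at hd
    have hins := Finset.insert_eq_of_mem hΔτ.1
    rw [← hins]
    refine .boxR _ _ j _ (hins.symm ▸ hj) ?_
    rw [← hτi]
    exact hd
  | boxL α n i φ hβ _ ih =>
    rw [Finset.forall_mem_insert] at hΓ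
    rw [← Finset.insert_eq_of_mem hΓ.1]
    exact .boxL _ _ (ρ i) _ (Finset.mem_image_of_mem (Label.rename σ ρ) hβ)
      (ih hσ ρ (LForm.rename_mem_insert _ hΓ.2) hΔ)
  | wlab α hT _ ih =>
    have hT' := hT.rename σ ρ
    rw [Finset.image_insert] at hT' ⊢
    exact .wlab _ hT' (ih hσ ρ hΓ hΔ)
  | cut α n φ hc hα _ _ ih₁ ih₂ =>
    rw [Finset.forall_mem_union] at hΓ hΔ
    rw [← Finset.union_self Γ', ← Finset.union_self Δ']
    exact .cut _ _ _ hc (Finset.mem_image_of_mem _ hα)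
      (ih₁ hσ ρ hΓ.1 (LForm.rename_mem_insert _ hΔ.1))
      (ih₂ hσ ρ (LForm.rename_mem_insert _ hΓ.2) hΔ.2)

/-- height-preserving admissibility of weakening (wR) and (wL)
    in TEFL⁻ (c = false) and TEFL (c = true). -/
theorem weakening_hp_admissible (c : Bool) (T : Finset Label) (Γ Δ : Finset LForm)
    (α : Label) (n : ℕ) (φ : Form) (h : ℕ)
    (hα : α ∈ T) (hd : Deriv c T Γ Δ h) :
    (∃ h' ≤ h, Deriv c T Γ (insert (α, Form.atf n φ) Δ) h') ∧
    (∃ h' ≤ h, Deriv c T (insert (α, Form.atf n φ) Γ) Δ h') := by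
  have weaken {Γ' Δ' : Finset LForm} (hΓ : Γ ⊆ Γ') (hΔ : Δ ⊆ Δ') : Deriv c T Γ' Δ' h := by
    have hid : Label.rename id id = id := funext Label.rename_id
    have := hd.rename_weaken Function.injective_id id (Γ' := Γ') (Δ' := Δ')
      (fun l hl => (LForm.rename_id l).symm ▸ hΓ hl)
      (fun l hl => (LForm.rename_id l).symm ▸ hΔ hl)
    rwa [hid, Finset.image_id] at this
  exact ⟨⟨h, le_rfl, weaken subset_rfl (Finset.subset_insert _ _)⟩,
    ⟨h, le_rfl, weaken (Finset.subset_insert _ _) subset_rfl⟩⟩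
end

section
/- Truth lemma: let Γ ⇒^T Δ be a saturated, possibly infinite tree sequent that is unprovable in TEFL⁻. Define an equivalence relation ~ on nominals by n ~ m iff α:@_n m ∈ Γ for some α ∈ T, and define the derived model M = (T, A, (R_a), (≍_α), V) by: A := the set of ~-equivalence classes |n|; α R_{|n|} β iff β is an m-child of α for some m ∈ |n|; |n| ≍_α |m| iff α:@_n⟨F⟩m ∈ Γ; (α,|n|) ∈ V(m) iff α:@_n m ∈ Γ for nominals m; (α,|n|) ∈ V(p) iff α:@_n p ∈ Γ for propositional variables p. Then M is a well-defined model (in particular ~ is an equivalence relation, R_{|n|} and ≍_α are well-defined, and V(m) = T×{|m|} for every nominal m), and for every labelled formula α:@_nφ: (i) if α:@_nφ ∈ Γ then M,(α,|n|) ⊨ φ, and (ii) if α:@_nφ ∈ Δ then M,(α,|n|) ⊭ φ. -/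
set_option autoImplicit false

theorem Form.sub_eq_self_of_notMem {m k : ℕ} {φ : Form} (hk : k ∉ φ.noms) :
    Form.sub m k φ = φ := by
  induction φ with
  | nom n =>
    rw [Form.noms, Finset.mem_singleton] at hk
    simp [Form.sub, Ne.symm hk]
  | pv p => rfl
  | bot => rfl
  | imp φ ψ ihφ ihψ => simp_all [Form.sub, Form.noms]
  | atf n φ ih =>
    rw [Form.noms, Finset.mem_insert, not_or] at hk
    simp [Form.sub, Ne.symm hk.1, ih hk.2]
  | fr φ ih => simp_all [Form.sub, Form.noms]
  | box φ ih => simp_all [Form.sub, Form.noms]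

namespace Saturated

variable {T : Set Label} {Γ Δ : Set LForm}

theorem atf_congr (hs : Saturated T Γ Δ) {α : Label} {n m : ℕ} {φ : Form}
    (hnm : (α, Form.atf n (Form.nom m)) ∈ Γ) (hφ : (α, Form.atf n φ) ∈ Γ) :
    (α, Form.atf m φ) ∈ Γ := by
  obtain ⟨k, hk⟩ := Infinite.exists_notMem_finset φ.noms
  have h := hs.rep1 α n m k (Form.atf k φ) hnm
  simp only [Form.sub, if_true, Form.sub_eq_self_of_notMem hk] at h
  exact h hφ

theorem diaF_congr (hs : Saturated T Γ Δ) {α : Label} {n m l : ℕ}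
    (hml : (α, Form.atf m (Form.nom l)) ∈ Γ)
    (h : (α, Form.atf n (Form.diaF (Form.nom m))) ∈ Γ) :
    (α, Form.atf n (Form.diaF (Form.nom l))) ∈ Γ := by
  have h' := hs.rep1 α m l (n + 1) (Form.atf n (Form.diaF (Form.nom (n + 1)))) hml
  simp only [Form.sub, Form.diaF, Form.neg, if_true, Nat.ne_of_lt (Nat.lt_succ_self n),
    if_false] at h'
  exact h' h

theorem nrel_iff (hs : Saturated T Γ Δ) {α : Label} (hα : α ∈ T) {n m : ℕ} :
    nrel T Γ n m ↔ (α, Form.atf n (Form.nom m)) ∈ Γ :=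
  ⟨fun ⟨β, _, h⟩ => hs.rigid β α n m hα h, fun h => ⟨α, hα, h⟩⟩

theorem equivalence_nrel (hs : Saturated T Γ Δ) (hne : T.Nonempty) :
    Equivalence (nrel T Γ) := by
  obtain ⟨α, hα⟩ := hne
  have symm : ∀ {n m}, nrel T Γ n m → nrel T Γ m n := fun h => by
    rw [hs.nrel_iff hα] at h ⊢
    exact hs.atf_congr h (hs.refl α hα _)
  refine ⟨fun n => ⟨α, hα, hs.refl α hα n⟩, symm, fun hnm hml => ?_⟩
  have hmn := symm hnm
  rw [hs.nrel_iff hα] at hmn hml ⊢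
  exact hs.atf_congr hmn hml

theorem mk_eq_mk_iff (hs : Saturated T Γ Δ) {α : Label} (hα : α ∈ T) {n m : ℕ} :
    Quot.mk (nrel T Γ) n = Quot.mk (nrel T Γ) m ↔ (α, Form.atf n (Form.nom m)) ∈ Γ := by
  rw [(hs.equivalence_nrel ⟨α, hα⟩).quot_mk_eq_iff, hs.nrel_iff hα]

end Saturated

theorem isTree_singleton_root (j : ℕ) : IsTree {Label.root j} := by
  refine ⟨⟨j, by simp, fun i hi => by simpa using hi⟩, fun α n i h => by simp at h⟩

section Unprovable

variable {T : Set Label} {Γ Δ : Set LForm}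

theorem notMem_right_of_not_infProvable (hT : SetIsTree T) (hunp : ¬ InfProvable T Γ Δ)
    {α : Label} {n : ℕ} {φ : Form} (h : (α, Form.atf n φ) ∈ Γ) : (α, Form.atf n φ) ∉ Δ := by
  obtain ⟨j, hj, -⟩ := hT.1
  exact fun h' => hunp ⟨{Label.root j}, {(α, Form.atf n φ)}, {(α, Form.atf n φ)},
    by simpa using hj, isTree_singleton_root j, by simpa using h, by simpa using h',
    0, Deriv.id (Γ := ∅) (Δ := ∅) α n φ⟩

theorem atf_bot_notMem_of_not_infProvable (hT : SetIsTree T) (hunp : ¬ InfProvable T Γ Δ)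
    {α : Label} {n : ℕ} : (α, Form.atf n Form.bot) ∉ Γ := by
  obtain ⟨j, hj, -⟩ := hT.1
  exact fun h => hunp ⟨{Label.root j}, {(α, Form.atf n Form.bot)}, ∅,
    by simpa using hj, isTree_singleton_root j, by simpa using h, by simp,
    0, Deriv.bot (Γ := ∅) α n⟩

end Unprovable

/-- The derived model of a tree sequent. -/
def derivedModel (T : Set Label) (Γ : Set LForm) (hne : Nonempty {α : Label // α ∈ T}) :
    Model {α : Label // α ∈ T} (Quot (nrel T Γ)) where
  wne := hne
  ane := ⟨Quot.mk _ 0⟩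
  R a α β := ∃ m i : ℕ, Quot.mk (nrel T Γ) m = a ∧ (β : Label) = Label.child (α : Label) m i
  friend α a b := ∃ n m : ℕ, Quot.mk (nrel T Γ) n = a ∧ Quot.mk (nrel T Γ) m = b ∧
    ((α : Label), Form.atf n (Form.diaF (Form.nom m))) ∈ Γ
  Vp p α a := ∃ n : ℕ, Quot.mk (nrel T Γ) n = a ∧ ((α : Label), Form.atf n (Form.pv p)) ∈ Γ
  Vn := Quot.mk _

namespace Saturated

variable {T : Set Label} {Γ Δ : Set LForm}

theorem derivedModel_friend_iff (hs : Saturated T Γ Δ) (hne : Nonempty {α : Label // α ∈ T})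
    (α : {α : Label // α ∈ T}) (n m : ℕ) :
    (derivedModel T Γ hne).friend α (Quot.mk _ n) (Quot.mk _ m) ↔
      ((α : Label), Form.atf n (Form.diaF (Form.nom m))) ∈ Γ := by
  refine ⟨?_, fun h => ⟨n, m, rfl, rfl, h⟩⟩
  rintro ⟨n', m', hn, hm, h⟩
  rw [hs.mk_eq_mk_iff α.2] at hn hm
  exact hs.diaF_congr hm (hs.atf_congr hn h)

theorem derivedModel_Vp_iff (hs : Saturated T Γ Δ) (hne : Nonempty {α : Label // α ∈ T})
    (p : ℕ) (α : {α : Label // α ∈ T}) (n : ℕ) :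
    (derivedModel T Γ hne).Vp p α (Quot.mk _ n) ↔
      ((α : Label), Form.atf n (Form.pv p)) ∈ Γ := by
  refine ⟨?_, fun h => ⟨n, rfl, h⟩⟩
  rintro ⟨n', hn, h⟩
  exact hs.atf_congr ((hs.mk_eq_mk_iff α.2).1 hn) h

theorem sat_derivedModel (hs : Saturated T Γ Δ) (hT : SetIsTree T)
    (hunp : ¬ InfProvable T Γ Δ) (hne : Nonempty {α : Label // α ∈ T}) (φ : Form)
    (α : {α : Label // α ∈ T}) (n : ℕ) :
    (((α : Label), Form.atf n φ) ∈ Γ → Sat (derivedModel T Γ hne) α (Quot.mk _ n) φ) ∧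
      (((α : Label), Form.atf n φ) ∈ Δ → ¬ Sat (derivedModel T Γ hne) α (Quot.mk _ n) φ) := by
  induction φ generalizing α n with
  | nom m =>
    have key : Sat (derivedModel T Γ hne) α (Quot.mk _ n) (Form.nom m) ↔
        ((α : Label), Form.atf n (Form.nom m)) ∈ Γ :=
      eq_comm.trans (hs.mk_eq_mk_iff α.2)
    rw [key]
    exact ⟨id, fun hd hg => notMem_right_of_not_infProvable hT hunp hg hd⟩
  | pv p =>
    have key : Sat (derivedModel T Γ hne) α (Quot.mk _ n) (Form.pv p) ↔
        ((α : Label), Form.atf n (Form.pv p)) ∈ Γ :=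
      hs.derivedModel_Vp_iff hne p α n
    rw [key]
    exact ⟨id, fun hd hg => notMem_right_of_not_infProvable hT hunp hg hd⟩
  | bot => exact ⟨fun h => (atf_bot_notMem_of_not_infProvable hT hunp h).elim, fun _ h => h⟩
  | imp φ ψ ihφ ihψ =>
    refine ⟨fun h hφ => ?_, fun h hsat => ?_⟩
    · rcases hs.impL _ _ _ _ h with h | h
      · exact ((ihφ α n).2 h hφ).elim
      · exact (ihψ α n).1 h
    · obtain ⟨hφ, hψ⟩ := hs.impR _ _ _ _ h
      exact (ihψ α n).2 hψ (hsat ((ihφ α n).1 hφ))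
  | atf m φ ih =>
    exact ⟨fun h => (ih α m).1 (hs.atL _ _ _ _ h), fun h => (ih α m).2 (hs.atR _ _ _ _ h)⟩
  | fr φ ih =>
    refine ⟨fun h b hb => ?_, fun h hsat => ?_⟩
    · obtain ⟨m, rfl⟩ := Quot.exists_rep b
      rw [hs.derivedModel_friend_iff] at hb
      exact (ih α m).1 ((hs.frL _ _ _ h m).resolve_left
        (notMem_right_of_not_infProvable hT hunp hb))
    · obtain ⟨m, hm, hφ⟩ := hs.frR _ _ _ h
      exact (ih α m).2 hφ (hsat _ ((hs.derivedModel_friend_iff hne α n m).2 hm))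
  | box φ ih =>
    refine ⟨?_, fun h hsat => ?_⟩
    · rintro h ⟨_, hβ⟩ ⟨m, i, hm, rfl⟩
      rw [← hm]
      exact (ih _ m).1 (hs.boxL _ _ _
        (hs.atf_congr ((hs.mk_eq_mk_iff α.2).1 hm.symm) h) i hβ)
    · obtain ⟨i, hi, hφ⟩ := hs.boxR _ _ _ h
      exact (ih ⟨_, hi⟩ n).2 hφ (hsat _ ⟨n, i, rfl, rfl⟩)

end Saturated

/-- Truth lemma for the derived model of a saturated unprovable
    possibly infinite tree sequent. -/
theorem truth_lemma (T : Set Label) (Γ Δ : Set LForm)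
    (hT : SetIsTree T) (hΓ : ∀ l ∈ Γ, Prod.fst l ∈ T) (hΔ : ∀ l ∈ Δ, Prod.fst l ∈ T)
    (hsat : Saturated T Γ Δ) (hunp : ¬ InfProvable T Γ Δ) :
    Equivalence (nrel T Γ) ∧
    ∃ M : Model {α : Label // α ∈ T} (Quot (nrel T Γ)),
      (∀ n : ℕ, M.Vn n = Quot.mk (nrel T Γ) n) ∧
      (∀ (a : ℕ) (α β : {α : Label // α ∈ T}),
        M.R (Quot.mk (nrel T Γ) a) α β ↔
          ∃ (m i : ℕ), Quot.mk (nrel T Γ) m = Quot.mk (nrel T Γ) a ∧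
            (β : Label) = Label.child (α : Label) m i) ∧
      (∀ (α : {α : Label // α ∈ T}) (n m : ℕ),
        M.friend α (Quot.mk (nrel T Γ) n) (Quot.mk (nrel T Γ) m) ↔
          ((α : Label), Form.atf n (Form.diaF (Form.nom m))) ∈ Γ) ∧
      (∀ (m : ℕ) (α : {α : Label // α ∈ T}) (n : ℕ),
        ((α : Label), Form.atf n (Form.nom m)) ∈ Γ ↔
          Quot.mk (nrel T Γ) n = Quot.mk (nrel T Γ) m) ∧
      (∀ (p : ℕ) (α : {α : Label // α ∈ T}) (n : ℕ),
        M.Vp p α (Quot.mk (nrel T Γ) n) ↔ ((α : Label), Form.atf n (Form.pv p)) ∈ Γ) ∧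
      (∀ (α : {α : Label // α ∈ T}) (n : ℕ) (φ : Form),
        ((α : Label), Form.atf n φ) ∈ Γ → Sat M α (Quot.mk (nrel T Γ) n) φ) ∧
      (∀ (α : {α : Label // α ∈ T}) (n : ℕ) (φ : Form),
        ((α : Label), Form.atf n φ) ∈ Δ → ¬ Sat M α (Quot.mk (nrel T Γ) n) φ) := by
  obtain ⟨j, hj, -⟩ := hT.1
  have hne : Nonempty {α : Label // α ∈ T} := ⟨⟨_, hj⟩⟩
  exact ⟨hsat.equivalence_nrel ⟨_, hj⟩, derivedModel T Γ hne, fun _ => rfl,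
    fun _ _ _ => Iff.rfl, hsat.derivedModel_friend_iff hne,
    fun _ α _ => (hsat.mk_eq_mk_iff α.2).symm, hsat.derivedModel_Vp_iff hne,
    fun α n φ => (hsat.sat_derivedModel hT hunp hne φ α n).1,
    fun α n φ => (hsat.sat_derivedModel hT hunp hne φ α n).2⟩
end
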